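/- Let $p > 1$ and let $k \in \mathbb{N}$ be such that $k < p \le k+1$. Set $c(p) = 2^{\frac{k+1}{p} - 1}$. Then for all real numbers $a \ge b \ge 0$, one has $a^p + b^p + \sum_{j=1}^{k} \binom{p}{j} b^{p-j} (a-b)^j \le (c(p) a + b)^p$, where $\binom{p}{j}$ is the generalized binomial coefficient. -/

import Mathlib

open Real Finset

/-- Generalized binomial coefficient `p choose j` for real `p`. -/
noncomputable def genBinom (p : ℝ) (j : ℕ) : ℝ :=
  (∏ i ∈ Finset.range j, (p - i)) / (Nat.factorial j)

/-- The degree `k` Taylor polynomial of `x ↦ x ^ p` at `1`. -/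
noncomputable def rpowTaylor (p : ℝ) (k : ℕ) (x : ℝ) : ℝ :=
  ∑ j ∈ Finset.range (k + 1), genBinom p j * (x - 1) ^ j

theorem genBinom_zero (p : ℝ) : genBinom p 0 = 1 := by simp [genBinom]

theorem genBinom_succ_mul (p : ℝ) (j : ℕ) :
    genBinom p (j + 1) * (j + 1) = p * genBinom (p - 1) j := by
  have h : ∏ i ∈ Finset.range j, (p - ((i + 1 : ℕ) : ℝ)) = ∏ i ∈ Finset.range j, (p - 1 - i) :=
    Finset.prod_congr rfl fun i _ => by push_cast; ring
  have hj : (j.factorial : ℝ) ≠ 0 := by positivity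
  unfold genBinom
  rw [Finset.prod_range_succ', h, Nat.factorial_succ]
  push_cast
  field_simp
  ring

theorem rpowTaylor_zero (p x : ℝ) : rpowTaylor p 0 x = 1 := by
  simp [rpowTaylor, genBinom_zero]

theorem rpowTaylor_at_one (p : ℝ) (k : ℕ) : rpowTaylor p k 1 = 1 := by
  simp [rpowTaylor, Finset.sum_range_succ', genBinom_zero]

theorem hasDerivAt_rpowTaylor_succ (p : ℝ) (k : ℕ) (x : ℝ) :
    HasDerivAt (rpowTaylor p (k + 1)) (p * rpowTaylor (p - 1) k x) x := by
  have h : HasDerivAt (rpowTaylor p (k + 1))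
      (∑ j ∈ Finset.range (k + 1 + 1), genBinom p j * ((j : ℝ) * (x - 1) ^ (j - 1) * 1)) x := by
    refine (HasDerivAt.fun_sum fun j _ =>
      (((hasDerivAt_id x).sub_const 1).fun_pow j).const_mul (genBinom p j))
  convert h using 1
  rw [Finset.sum_range_succ', rpowTaylor, Finset.mul_sum]
  simp only [Nat.cast_zero, zero_mul, mul_zero, add_zero, Nat.add_sub_cancel, mul_one]
  refine Finset.sum_congr rfl fun j _ => ?_
  push_cast
  rw [← mul_assoc, ← mul_assoc, genBinom_succ_mul]

theorem rpowTaylor_one (p x : ℝ) : rpowTaylor p 1 x = 1 + p * (x - 1) := by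
  simp [rpowTaylor, Finset.sum_range_succ, genBinom]

/-- The difference of the two sides of the inequality, normalised to `b = 1`. -/
noncomputable def taylorGap (c p : ℝ) (k : ℕ) (x : ℝ) : ℝ :=
  (c * x + 1) ^ p - x ^ p - rpowTaylor p k x

theorem hasDerivAt_taylorGap_succ {c p x : ℝ} (k : ℕ) (hc : 0 < c) (hx : 0 < x) :
    HasDerivAt (taylorGap c p (k + 1))
      (p * (c * (c * x + 1) ^ (p - 1) - x ^ (p - 1) - rpowTaylor (p - 1) k x)) x := by
  have h1 : HasDerivAt (fun y : ℝ => c * y + 1) (c * 1) x :=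
    ((hasDerivAt_id x).const_mul c).add_const 1
  have h2 := h1.rpow_const (p := p) (Or.inl (by positivity))
  have h3 := Real.hasDerivAt_rpow_const (x := x) (p := p) (Or.inl hx.ne')
  refine ((h2.sub h3).sub (hasDerivAt_rpowTaylor_succ p k x)).congr_deriv ?_
  ring

theorem taylorGap_one_nonneg {c p : ℝ} (k : ℕ) (hc : 1 ≤ c) (hp : 1 ≤ p) :
    0 ≤ taylorGap c p k 1 := by
  have h1 : (2 : ℝ) ^ (1 : ℝ) ≤ 2 ^ p := Real.rpow_le_rpow_of_exponent_le (by norm_num) hp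
  have h2 : (2 : ℝ) ^ p ≤ (c * 1 + 1) ^ p :=
    Real.rpow_le_rpow (by norm_num) (by linarith) (by linarith)
  rw [Real.rpow_one] at h1
  rw [taylorGap, rpowTaylor_at_one, Real.one_rpow]
  linarith

theorem taylorGap_monotoneOn {c p r : ℝ} (k : ℕ) (hc : 0 < c) (hp : 0 ≤ p) (hr : 0 < r)
    (h : ∀ x, r ≤ x → x ^ (p - 1) + rpowTaylor (p - 1) k x ≤ c * (c * x + 1) ^ (p - 1)) :
    MonotoneOn (taylorGap c p (k + 1)) (Set.Ici r) := by
  refine monotoneOn_of_hasDerivWithinAt_nonneg (convex_Ici r)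
    (f' := fun x => p * (c * (c * x + 1) ^ (p - 1) - x ^ (p - 1) - rpowTaylor (p - 1) k x))
    (fun x hx => (hasDerivAt_taylorGap_succ k hc
      (hr.trans_le hx)).continuousAt.continuousWithinAt) ?_ ?_
  · intro x hx
    rw [interior_Ici] at hx
    exact (hasDerivAt_taylorGap_succ k hc (hr.trans hx)).hasDerivWithinAt
  · intro x hx
    rw [interior_Ici] at hx
    exact mul_nonneg hp (by linarith [h x (le_of_lt hx)])

theorem one_le_two_rpow_div_sub_one {n p : ℝ} (hp : 0 < p) (h : p ≤ n) :
    1 ≤ (2 : ℝ) ^ (n / p - 1) := by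
  refine Real.one_le_rpow (by norm_num) ?_
  have : 1 ≤ n / p := (one_le_div hp).2 h
  linarith

theorem sinh_mul_le {m t : ℝ} (hm0 : 0 ≤ m) (hm1 : m ≤ 1) (ht : 0 ≤ t) :
    Real.sinh (m * t) ≤ m * Real.sinh t := by
  have hd : ∀ x : ℝ, HasDerivAt (fun y => m * Real.sinh y - Real.sinh (m * y))
      (m * Real.cosh x - Real.cosh (m * x) * (m * 1)) x := fun x =>
    ((Real.hasDerivAt_sinh x).const_mul m).sub
      ((Real.hasDerivAt_sinh (m * x)).comp x ((hasDerivAt_id x).const_mul m))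
  have hmono : MonotoneOn (fun y => m * Real.sinh y - Real.sinh (m * y)) (Set.Ici 0) := by
    refine monotoneOn_of_hasDerivWithinAt_nonneg (convex_Ici 0)
      (fun x _ => (hd x).continuousAt.continuousWithinAt)
      (fun x _ => (hd x).hasDerivWithinAt) fun x hx => ?_
    rw [interior_Ici] at hx
    have hx0 : 0 < x := hx
    have : Real.cosh (m * x) ≤ Real.cosh x := by
      rw [Real.cosh_le_cosh, abs_of_nonneg (by positivity), abs_of_pos hx0]
      nlinarith
    nlinarith
  have := hmono (Set.mem_Ici.2 le_rfl) (Set.mem_Ici.2 ht) ht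
  simp only [mul_zero, Real.sinh_zero, sub_zero] at this
  linarith

theorem four_rpow_add_one_le {m : ℝ} (hm0 : 0 ≤ m) (hm1 : m ≤ 1) :
    (4 : ℝ) ^ m + 1 ≤ 2 ^ m * (2 + m ^ 2 / 2) := by
  have hL : 0 ≤ Real.log 2 / 2 := by have := Real.log_pos (x := 2) (by norm_num); linarith
  have hs := sinh_mul_le hm0 hm1 hL
  have hs0 : 0 ≤ Real.sinh (m * (Real.log 2 / 2)) := Real.sinh_nonneg_iff.2 (by positivity)
  have hsq : Real.sinh (m * (Real.log 2 / 2)) ^ 2 ≤ m ^ 2 * Real.sinh (Real.log 2 / 2) ^ 2 := by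
    rw [← mul_pow]; exact pow_le_pow_left₀ hs0 hs 2
  have hdouble : ∀ t : ℝ, Real.sinh (t / 2) ^ 2 = (Real.cosh t - 1) / 2 := fun t => by
    have h1 := Real.cosh_two_mul (t / 2)
    have h2 := Real.cosh_sq (t / 2)
    rw [mul_div_cancel₀ t two_ne_zero] at h1
    linarith
  have hlog : Real.cosh (Real.log 2) = 5 / 4 := by
    rw [Real.cosh_log (by norm_num)]; norm_num
  rw [← mul_div_assoc, hdouble, hdouble, hlog] at hsq
  have hz : (2 : ℝ) ^ m = Real.exp (m * Real.log 2) := by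
    rw [Real.rpow_def_of_pos (by norm_num), mul_comm]
  have h4 : (4 : ℝ) ^ m = 2 ^ m * 2 ^ m := by
    rw [← Real.mul_rpow (by norm_num) (by norm_num)]; norm_num
  rw [Real.cosh_eq, Real.exp_neg, ← hz] at hsq
  have hpos : 0 < (2 : ℝ) ^ m := by positivity
  have hinv : (2 : ℝ) ^ m * (2 ^ m)⁻¹ = 1 := mul_inv_cancel₀ hpos.ne'
  have hle : (2 : ℝ) ^ m + (2 ^ m)⁻¹ ≤ 2 + m ^ 2 / 2 := by linarith
  have := mul_le_mul_of_nonneg_left hle hpos.le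
  rw [h4]
  linarith

theorem one_add_div_le_rpow {m u : ℝ} (hm1 : m ≤ 1) (hm0 : 0 ≤ m) (hu : 0 ≤ u) :
    (1 + u) / (1 + (1 - m) * u) ≤ (1 + u) ^ m := by
  have hb : (1 + u) ^ (1 - m) ≤ 1 + (1 - m) * u :=
    rpow_one_add_le_one_add_mul_self (by linarith) (by linarith) (by linarith)
  have hpos : 0 < 1 + (1 - m) * u := by nlinarith [mul_nonneg (sub_nonneg.2 hm1) hu]
  have h1 : (1 + u) ^ m * (1 + u) ^ (1 - m) = 1 + u := by
    rw [← Real.rpow_add (by linarith)]; simp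
  rw [div_le_iff₀ hpos]
  calc 1 + u = (1 + u) ^ m * (1 + u) ^ (1 - m) := h1.symm
    _ ≤ _ := mul_le_mul_of_nonneg_left hb (by positivity)

section BaseCase

variable {c m : ℝ}

theorem four_rpow_add_one_le_of_rpow_eq (hm0 : 0 < m) (hm1 : m ≤ 1) (hc : 0 < c)
    (hcp : c ^ (m + 1) = 2 ^ (1 - m)) (hc2 : c * (m + 1) ≤ 2) :
    (4 : ℝ) ^ m + 1 ≤ c * (c * 4 + 1) ^ m := by
  have h2 : 0 < (2 : ℝ) ^ m := by positivity
  have hu : (m + 1) / 8 ≤ 1 / (4 * c) := by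
    rw [div_le_div_iff₀ (by norm_num) (by positivity)]; linarith
  have hfac : c * (c * 4 + 1) ^ m = 2 * 2 ^ m * (1 + 1 / (4 * c)) ^ m := by
    have e1 : c * 4 + 1 = c * (2 * 2) * (1 + 1 / (4 * c)) := by field_simp; ring
    rw [e1, Real.mul_rpow (by positivity) (by positivity), Real.mul_rpow hc.le (by norm_num),
      Real.mul_rpow (by norm_num) (by norm_num)]
    have e2 : c * c ^ m * 2 ^ m = 2 := by
      rw [← Real.rpow_one_add' hc.le (by linarith), add_comm 1 m, hcp,
        ← Real.rpow_add (by norm_num)]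
      simp
    linear_combination (2 : ℝ) ^ m * (1 + 1 / (4 * c)) ^ m * e2
  have hbern := one_add_div_le_rpow hm1 hm0.le (u := (m + 1) / 8) (by positivity)
  have hmono : (1 + (m + 1) / 8) ^ m ≤ (1 + 1 / (4 * c)) ^ m :=
    Real.rpow_le_rpow (by positivity) (by linarith) hm0.le
  have hrat : 1 + m ^ 2 / 4 ≤ (1 + (m + 1) / 8) / (1 + (1 - m) * ((m + 1) / 8)) := by
    rw [le_div_iff₀ (by nlinarith)]
    have : 0 ≤ m * (1 - m) * (4 - m - m ^ 2) :=
      mul_nonneg (mul_nonneg hm0.le (by linarith)) (by nlinarith)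
    nlinarith
  rw [hfac]
  have := mul_le_mul_of_nonneg_left (hrat.trans (hbern.trans hmono)) h2.le
  linarith [four_rpow_add_one_le hm0.le hm1]

theorem rpow_add_one_le_of_four_le (hm0 : 0 < m) (hm1 : m ≤ 1) (hc : 1 ≤ c)
    (hcp : c ^ (m + 1) = 2 ^ (1 - m)) (hc2 : c * (m + 1) ≤ 2) {x : ℝ} (hx : 4 ≤ x) :
    x ^ m + 1 ≤ c * (c * x + 1) ^ m := by
  have hc0 : 0 < c := by linarith
  have hd : ∀ y : ℝ, 0 < y → HasDerivAt (fun z : ℝ => c * (c * z + 1) ^ m - z ^ m)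
      (c * (c * 1 * m * (c * y + 1) ^ (m - 1)) - m * y ^ (m - 1)) y := fun y hy =>
    (((((hasDerivAt_id y).const_mul c).add_const 1).rpow_const
      (Or.inl (by simp only [id]; positivity))).const_mul c).sub
      (Real.hasDerivAt_rpow_const (Or.inl hy.ne'))
  have hmono : MonotoneOn (fun z : ℝ => c * (c * z + 1) ^ m - z ^ m) (Set.Ici 4) := by
    refine monotoneOn_of_hasDerivWithinAt_nonneg (convex_Ici 4)
      (f' := fun y => c * (c * 1 * m * (c * y + 1) ^ (m - 1)) - m * y ^ (m - 1))
      (fun y hy => (hd y (by linarith [Set.mem_Ici.1 hy])).continuousAt.continuousWithinAt)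
      (fun y hy => ?_) fun y hy => ?_
    · rw [interior_Ici] at hy
      exact (hd y (by linarith [Set.mem_Ioi.1 hy])).hasDerivWithinAt
    · rw [interior_Ici] at hy
      have hy4 : 4 < y := hy
      have hy0 : 0 < y := by linarith
      have h1 : (c * y * 2) ^ (m - 1) ≤ (c * y + 1) ^ (m - 1) :=
        Real.rpow_le_rpow_of_nonpos (by positivity) (by nlinarith) (by linarith)
      have h2 : c * c * (c * y * 2) ^ (m - 1) = y ^ (m - 1) := by
        have e1 : c * c * c ^ (m - 1) = c ^ (m + 1) := by
          rw [mul_assoc, ← Real.rpow_one_add' hc0.le (by linarith),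
            ← Real.rpow_one_add' hc0.le (by linarith)]
          ring_nf
        have e2 : c ^ (m + 1) * 2 ^ (m - 1) = 1 := by
          rw [hcp, ← Real.rpow_add (by norm_num)]; simp
        rw [Real.mul_rpow (by positivity) (by norm_num), Real.mul_rpow hc0.le hy0.le]
        linear_combination y ^ (m - 1) * 2 ^ (m - 1) * e1 + y ^ (m - 1) * e2
      have h3 := mul_le_mul_of_nonneg_left h1 (mul_nonneg hc0.le hc0.le)
      rw [h2] at h3
      nlinarith [mul_le_mul_of_nonneg_left h3 hm0.le]
  have h := hmono (Set.mem_Ici.2 le_rfl) (Set.mem_Ici.2 hx) hx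
  have h4 := four_rpow_add_one_le_of_rpow_eq hm0 hm1 hc0 hcp hc2
  simp only at h
  linarith

theorem mul_sub_one_le_rpow_add_one (hm0 : 0 < m) (hm1 : m ≤ 1)
    (hc2 : c * (m + 1) ≤ 2) {x : ℝ} (hx1 : 1 ≤ x) (hx4 : x ≤ 4) :
    c * (m * (x - 1)) ≤ x ^ m + 1 := by
  have h4 : 1 + m ≤ (4 : ℝ) ^ m := by
    have hl : 1 ≤ Real.log 4 := by
      rw [Real.le_log_iff_exp_le (by norm_num)]
      linarith [Real.exp_one_lt_d9]
    have := Real.add_one_le_exp (Real.log 4 * m)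
    rw [Real.rpow_def_of_pos (by norm_num)]
    nlinarith
  have hchord : 1 + m * (x - 1) / 3 ≤ x ^ m := by
    have hconc := (Real.concaveOn_rpow hm0.le hm1).2
      (Set.mem_Ici.2 zero_le_one) (Set.mem_Ici.2 zero_le_four)
      (by linarith : 0 ≤ (4 - x) / 3) (by linarith : 0 ≤ (x - 1) / 3) (by ring)
    simp only [smul_eq_mul, Real.one_rpow] at hconc
    have e : (4 - x) / 3 * 1 + (x - 1) / 3 * 4 = x := by ring
    rw [e] at hconc
    nlinarith
  have hc3 : c * (m * (x - 1)) * (m + 1) ≤ 2 * (m * (x - 1)) := by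
    nlinarith [mul_nonneg hm0.le (sub_nonneg.2 hx1)]
  have hpoly : 2 * (m * (x - 1)) ≤ (2 + m * (x - 1) / 3) * (m + 1) := by
    nlinarith [mul_nonneg (sub_nonneg.2 hm1) (sub_nonneg.2 hx4),
      mul_nonneg hm0.le (sub_nonneg.2 hx1), mul_nonneg hm0.le (sub_nonneg.2 hx4),
      mul_nonneg (mul_nonneg hm0.le (sub_nonneg.2 hm1)) (sub_nonneg.2 hx4),
      mul_nonneg (mul_nonneg hm0.le (sub_nonneg.2 hm1)) (sub_nonneg.2 hx1),
      mul_nonneg (sub_nonneg.2 hm1) (by linarith : 0 ≤ 2 - m)]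
  have : c * (m * (x - 1)) ≤ 2 + m * (x - 1) / 3 :=
    le_of_mul_le_mul_right (hc3.trans hpoly) (by linarith)
  linarith

theorem taylorGap_nonneg_of_deriv_nonneg (hm0 : 0 < m) (hm1 : m ≤ 1) (hc : 0 < c)
    (hc2 : c * (m + 1) ≤ 2) {x : ℝ} (hx1 : 1 ≤ x) (hx4 : x ≤ 4)
    (h : x ^ m + 1 ≤ c * (c * x + 1) ^ m) : 0 ≤ taylorGap c (m + 1) 1 x := by
  have hx0 : 0 < x := by linarith
  have hcx : 0 < c * x + 1 := by positivity
  have h1 := mul_sub_one_le_rpow_add_one hm0 hm1 hc2 hx1 hx4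
  have h2 := mul_le_mul_of_nonneg_left h hcx.le
  rw [taylorGap, rpowTaylor_one, Real.rpow_add_one hcx.ne', Real.rpow_add_one hx0.ne']
  refine nonneg_of_mul_nonneg_right (?_ : 0 ≤ c * _) hc
  nlinarith

theorem taylorGap_one_step_nonneg (hm0 : 0 < m) (hm1 : m ≤ 1) (hc : 1 ≤ c)
    (hcp : c ^ (m + 1) = 2 ^ (1 - m)) (hc2 : c * (m + 1) ≤ 2) {x : ℝ} (hx : 1 ≤ x) :
    0 ≤ taylorGap c (m + 1) 1 x := by
  have hc0 : 0 < c := by linarith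
  have hbig : ∀ y : ℝ, 4 ≤ y → y ^ m + 1 ≤ c * (c * y + 1) ^ m := fun y hy =>
    rpow_add_one_le_of_four_le hm0 hm1 hc hcp hc2 hy
  have hd : ∀ y : ℝ, 0 < y → HasDerivAt (taylorGap c (m + 1) 1)
      ((m + 1) * (c * (c * y + 1) ^ m - y ^ m - 1)) y := fun y hy => by
    simpa [rpowTaylor_zero] using hasDerivAt_taylorGap_succ (p := m + 1) 0 hc0 hy
  have hsmall : ∀ y ∈ Set.Icc (1 : ℝ) 4, 0 ≤ taylorGap c (m + 1) 1 y := by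
    obtain ⟨z, hz, hmin⟩ := isCompact_Icc.exists_isMinOn (Set.nonempty_Icc.2 (by norm_num))
      (fun y hy => (hd y (by linarith [hy.1])).continuousAt.continuousWithinAt :
        ContinuousOn (taylorGap c (m + 1) 1) (Set.Icc (1 : ℝ) 4))
    refine fun y hy => le_trans ?_ (hmin hy)
    rcases hz.1.eq_or_lt with h1 | h1
    · rw [← h1]; exact taylorGap_one_nonneg 1 hc (by linarith)
    refine taylorGap_nonneg_of_deriv_nonneg hm0 hm1 hc0 hc2 hz.1 hz.2 ?_
    rcases hz.2.eq_or_lt with h4 | h4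
    · exact hbig z h4.ge
    · have h0 := (hmin.isLocalMin (Icc_mem_nhds h1 h4)).hasDerivAt_eq_zero (hd z (by linarith))
      have := (mul_eq_zero.1 h0).resolve_left (by linarith)
      linarith
  rcases le_total x 4 with h | h
  · exact hsmall x ⟨hx, h⟩
  · refine (hsmall 4 (by norm_num)).trans
      (taylorGap_monotoneOn 0 hc0 (by linarith) (by norm_num : (0 : ℝ) < 4) ?_
        (Set.mem_Ici.2 le_rfl) (Set.mem_Ici.2 h) h)
    intro y hy
    simpa [rpowTaylor_zero] using hbig y hy

end BaseCase

theorem taylorGap_nonneg (k : ℕ) : ∀ p : ℝ, (k : ℝ) + 1 < p → p ≤ k + 2 → ∀ x : ℝ, 1 ≤ x →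
    0 ≤ taylorGap (2 ^ ((k + 2 : ℝ) / p - 1)) p (k + 1) x := by
  induction k with
  | zero =>
    intro p hp1 hp2 x hx
    simp only [Nat.cast_zero, zero_add] at hp1 hp2 ⊢
    have hp0 : 0 < p := by linarith
    have key := taylorGap_one_step_nonneg (c := 2 ^ (2 / p - 1)) (m := p - 1)
      (by linarith) (by linarith) (one_le_two_rpow_div_sub_one hp0 hp2) ?_ ?_ hx
    · simpa using key
    · rw [← Real.rpow_mul (by norm_num)]
      congr 1
      field_simp
      ring
    · have h1 : 1 ≤ 2 / p := (one_le_div hp0).2 hp2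
      have h2 : 2 / p ≤ 2 := div_le_self (by norm_num) hp1.le
      have h3 : (1 + 1 : ℝ) ^ (2 / p - 1) ≤ 1 + (2 / p - 1) * 1 :=
        rpow_one_add_le_one_add_mul_self (by norm_num) (by linarith) (by linarith)
      rw [one_add_one_eq_two, mul_one, add_sub_cancel] at h3
      rw [sub_add_cancel]
      exact (le_div_iff₀ hp0).1 h3
  | succ k ih =>
    intro p hp1 hp2 x hx
    push_cast at hp1 hp2 ⊢
    have hk : (0 : ℝ) ≤ k := Nat.cast_nonneg k
    have hp0 : 0 < p := by linarith
    have hq0 : 0 < p - 1 := by linarith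
    have hc1 : 1 ≤ (2 : ℝ) ^ ((k + 1 + 2 : ℝ) / p - 1) :=
      one_le_two_rpow_div_sub_one hp0 (by linarith)
    have hcc : (2 : ℝ) ^ ((k + 1 + 2 : ℝ) / p - 1) *
        (2 ^ ((k + 1 + 2 : ℝ) / p - 1)) ^ (p - 1)⁻¹ = 2 ^ ((k + 2 : ℝ) / (p - 1) - 1) := by
      rw [← Real.rpow_mul (by norm_num), ← Real.rpow_add (by norm_num)]
      congr 1
      field_simp
      ring
    set c : ℝ := 2 ^ ((k + 1 + 2 : ℝ) / p - 1)
    have hc0 : 0 < c := by linarith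
    refine (taylorGap_one_nonneg (k + 1 + 1) hc1 (by linarith)).trans
      (taylorGap_monotoneOn (k + 1) hc0 hp0.le one_pos ?_
        (Set.mem_Ici.2 le_rfl) (Set.mem_Ici.2 hx) hx)
    intro y hy
    have hy0 : 0 < y := by linarith
    have hgap := ih (p - 1) (by linarith) (by linarith) y hy
    rw [taylorGap, ← hcc] at hgap
    have he1 : 1 ≤ c ^ (p - 1)⁻¹ := Real.one_le_rpow hc1 (by positivity)
    have hle : (c * c ^ (p - 1)⁻¹ * y + 1) ^ (p - 1) ≤ c * (c * y + 1) ^ (p - 1) :=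
      calc (c * c ^ (p - 1)⁻¹ * y + 1) ^ (p - 1)
          ≤ (c ^ (p - 1)⁻¹ * (c * y + 1)) ^ (p - 1) :=
            Real.rpow_le_rpow (by positivity) (by linarith) hq0.le
        _ = c * (c * y + 1) ^ (p - 1) := by
            rw [Real.mul_rpow (by positivity) (by positivity), Real.rpow_inv_rpow hc0.le hq0.ne']
    linarith

theorem stmt1 (p : ℝ) (k : ℕ) (hp : 1 < p) (hk1 : (k : ℝ) < p) (hk2 : p ≤ k + 1)
    (a b : ℝ) (hb : 0 ≤ b) (hab : b ≤ a) :
    a ^ p + b ^ p + ∑ j ∈ Finset.Icc 1 k, genBinom p j * b ^ (p - j) * (a - b) ^ (j : ℕ)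
      ≤ ((2 : ℝ) ^ ((k + 1 : ℝ) / p - 1) * a + b) ^ p := by
  have hp0 : 0 < p := by linarith
  have hc1 : 1 ≤ (2 : ℝ) ^ ((k + 1 : ℝ) / p - 1) := one_le_two_rpow_div_sub_one hp0 hk2
  rcases hb.eq_or_lt with rfl | hb0
  · have hsum : ∑ j ∈ Finset.Icc 1 k, genBinom p j * (0 : ℝ) ^ (p - j) * (a - 0) ^ j = 0 := by
      refine Finset.sum_eq_zero fun j hj => ?_
      have : (j : ℝ) ≤ k := Nat.cast_le.2 (Finset.mem_Icc.1 hj).2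
      rw [Real.zero_rpow (by linarith), mul_zero, zero_mul]
    rw [hsum, Real.zero_rpow hp0.ne', add_zero, add_zero, add_zero]
    exact Real.rpow_le_rpow hab (le_mul_of_one_le_left hab hc1) hp0.le
  obtain ⟨n, rfl⟩ : ∃ n, k = n + 1 := Nat.exists_eq_succ_of_ne_zero fun h => by
    rw [h, Nat.cast_zero] at hk2; linarith
  have hx : 1 ≤ a / b := (one_le_div hb0).2 hab
  have ha0 : 0 ≤ a / b := by linarith
  have hgap := taylorGap_nonneg n p (by push_cast at hk1; linarith)
    (by push_cast at hk2; linarith) (a / b) hx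
  have hexp : ((n + 1 : ℕ) : ℝ) + 1 = n + 2 := by push_cast; ring
  rw [hexp] at hc1 ⊢
  set c : ℝ := 2 ^ ((n + 2 : ℝ) / p - 1)
  have hab' : a = b * (a / b) := by field_simp
  have hsum : b ^ p + ∑ j ∈ Finset.Icc 1 (n + 1), genBinom p j * b ^ (p - j) * (a - b) ^ j
      = b ^ p * rpowTaylor p (n + 1) (a / b) := by
    rw [rpowTaylor, Finset.sum_range_eq_add_Ico _ (by omega), mul_add, genBinom_zero, pow_zero,
      mul_one, mul_one, Finset.mul_sum]
    congr 1
    refine Finset.sum_congr rfl fun j _ => ?_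
    have e : a - b = b * (a / b - 1) := by field_simp
    rw [e, mul_pow, Real.rpow_sub hb0, Real.rpow_natCast]
    field_simp
  have hap : a ^ p = b ^ p * (a / b) ^ p := by
    rw [← Real.mul_rpow hb ha0, ← hab']
  have hrhs : (c * a + b) ^ p = b ^ p * (c * (a / b) + 1) ^ p := by
    rw [← Real.mul_rpow hb (by positivity)]
    congr 1
    field_simp
  rw [add_assoc, hsum, hap, hrhs]
  have hbp : 0 ≤ b ^ p := by positivity
  have := mul_nonneg hbp hgap
  rw [taylorGap] at this
  linarith
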